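/- arXiv:2212.03713 — 2 statements merged into one kernel-verified Lean document; each statement's English description precedes it below -/
import Mathlib

section
/- Let R be a flat ℤ[ρ]-algebra which is an integrally closed domain, and let a ∈ R with 1 + aη^p ∈ R*. Then T = R[Z]/(Z^p + g(Z) - a), with automorphism σ determined by σ(θ) = ρθ + 1 on the image θ of Z, is a cyclic Galois extension of R of degree p. Conversely, if 1 + aη^p is not invertible then Z^p + g(Z) - a is not separable over R. -/
open scoped TensorProduct

/-- The canonical map `S ⊗[R] S → ∏_{g ∈ G} S`, `s ⊗ t ↦ (s · g(t))_g`, whose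
bijectivity (together with finiteness and projectivity of `S` over `R`) defines a
`G`-Galois extension of commutative rings. -/
noncomputable def galMap (R S G : Type*) [CommRing R] [CommRing S] [Algebra R S]
    [Group G] (act : G →* (S ≃ₐ[R] S)) : S ⊗[R] S →ₗ[R] (G → S) :=
  TensorProduct.lift
    (LinearMap.mk₂ R (fun s t g => s * act g t)
      (fun s s' t => by funext g; simp [add_mul])
      (fun c s t => by funext g; simp [smul_mul_assoc])
      (fun s t t' => by funext g; simp [mul_add])
      (fun c s t => by funext g; simp [mul_smul_comm]))

/-- `S/R` is a `G`-Galois extension of commutative rings. -/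
def IsGaloisExt (R S G : Type*) [CommRing R] [CommRing S] [Algebra R S]
    [Group G] (act : G →* (S ≃ₐ[R] S)) : Prop :=
  Module.Finite R S ∧ Module.Projective R S ∧ Function.Bijective (galMap R S G act)
open scoped NumberField

/-- `R[Z]/(f)`. -/
abbrev PolyQuot (R : Type*) [CommRing R] (f : Polynomial R) : Type _ :=
  Polynomial R ⧸ Ideal.span {f}

theorem galMap_tmul {R S G : Type*} [CommRing R] [CommRing S] [Algebra R S]
    [Group G] (act : G →* (S ≃ₐ[R] S)) (s t : S) (g : G) :
    galMap R S G act (s ⊗ₜ[R] t) g = s * act g t := rfl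

/-- If the conjugates of a generator of a power basis have pairwise invertible differences,
then `galMap` is bijective. -/
theorem galMap_bijective_of_powerBasis {R S G : Type*} [CommRing R] [CommRing S] [Algebra R S]
    [Group G] (act : G →* (S ≃ₐ[R] S)) (pb : PowerBasis R S) (e : Fin pb.dim ≃ G)
    (h : ∀ i j, i < j → IsUnit (act (e j) pb.gen - act (e i) pb.gen)) :
    Function.Bijective (galMap R S G act) := by
  set V : Matrix (Fin pb.dim) (Fin pb.dim) S :=
    Matrix.vandermonde fun i => act (e i) pb.gen with hV
  have hdet : IsUnit V.det := by
    rw [hV, Matrix.det_vandermonde]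
    refine IsUnit.prod_univ_iff.2 fun i => IsUnit.prod_iff.2 fun j hj => h i j ?_
    simpa using hj
  have hunit : IsUnit V := (Matrix.isUnit_iff_isUnit_det V).2 hdet
  have hbij : Function.Bijective V.mulVec :=
    ⟨Matrix.mulVec_injective_of_isUnit hunit, Matrix.mulVec_surjective_iff_isUnit.2 hunit⟩
  let B := pb.basis.baseChange S
  have hcomp : galMap R S G act ∘ B.equivFun.symm =
      (Equiv.arrowCongr e (Equiv.refl S)) ∘ V.mulVec := by
    funext c g
    simp only [Function.comp_apply, B, Module.Basis.equivFun_symm_apply, map_sum,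
      Finset.sum_apply, Module.Basis.baseChange_apply, TensorProduct.smul_tmul', galMap_tmul,
      PowerBasis.basis_eq_pow, Equiv.arrowCongr_apply, Equiv.coe_refl, id, Matrix.mulVec,
      dotProduct, hV, Matrix.vandermonde_apply, Equiv.apply_symm_apply, map_pow, smul_eq_mul,
      mul_one]
    exact Finset.sum_congr rfl fun _ _ => mul_comm _ _
  rw [← Function.Bijective.of_comp_iff _ B.equivFun.symm.bijective, hcomp]
  exact (Equiv.bijective _).comp hbij

/-- The action of `ZMod n` by powers of an element of exponent `n`. -/
theorem exists_zmod_hom {A : Type*} [Group A] (n : ℕ) (x : A) (hx : x ^ n = 1) :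
    ∃ φ : Multiplicative (ZMod n) →* A, φ (Multiplicative.ofAdd 1) = x := by
  refine ⟨AddMonoidHom.toMultiplicativeLeft
    (ZMod.lift n ⟨zmultiplesHom (Additive A) (Additive.ofMul x), ?_⟩), ?_⟩
  · rw [zmultiplesHom_apply, natCast_zsmul, ← ofMul_pow, hx, ofMul_one]
  · have := ZMod.lift_coe n ⟨zmultiplesHom (Additive A) (Additive.ofMul x), by
      rw [zmultiplesHom_apply, natCast_zsmul, ← ofMul_pow, hx, ofMul_one]⟩ 1
    rw [Int.cast_one] at this
    simp [this]

open Polynomial in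
/-- A polynomial `f` with `c ^ n * f = (1 + c * X) ^ n - u`, where `u = 1 + a * c ^ n`,
is not separable unless `u` is a unit. -/
theorem isUnit_of_separable {R : Type*} [CommRing R] {n : ℕ} (hn : 2 ≤ n)
    {f : R[X]} {c a : R}
    (hf : C (c ^ n) * f = (1 + C c * X) ^ n - C (1 + a * c ^ n)) (hsep : f.Separable) :
    IsUnit (1 + a * c ^ n) := by
  by_contra hu
  obtain ⟨m, hm, hum⟩ := exists_max_ideal_of_mem_nonunits hu
  let := Ideal.Quotient.field m
  let q := Ideal.Quotient.mk m
  have hu0 : 1 + q a * q c ^ n = 0 := by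
    simpa [q] using (Ideal.Quotient.eq_zero_iff_mem (I := m)).2 hum
  have hc : q c ≠ 0 := by
    intro h
    rw [h, zero_pow (by omega), mul_zero, add_zero] at hu0
    exact one_ne_zero hu0
  have hfq : C (q c ^ n) * f.map q = (1 + C (q c) * X) ^ n := by
    have hu : q (1 + a * c ^ n) = 0 := by simpa using hu0
    simpa [hu, -map_add] using congrArg (Polynomial.map q) hf
  have hsq := hsep.map (f := q)
  have hdvd : (1 + C (q c) * X) * (1 + C (q c) * X) ∣ f.map q := by
    have hcu : IsUnit (C (q c ^ n)) := (isUnit_iff_ne_zero.2 (pow_ne_zero n hc)).map C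
    rw [← hcu.dvd_mul_left, hfq, ← pow_two]
    exact pow_dvd_pow _ hn
  have hun := hsq.squarefree _ hdvd
  have := hun.map (evalRingHom (-(q c)⁻¹))
  simp [hc] at this

theorem finEquiv_eq_natCast (n : ℕ) [NeZero n] (i : Fin n) :
    ZMod.finEquiv n i = ((i : ℕ) : ZMod n) := by
  obtain ⟨m, rfl⟩ := Nat.exists_eq_succ_of_ne_zero (NeZero.ne n)
  exact (Fin.cast_val_eq_self i).symm

theorem AlgHom.iterate_affine {R S : Type*} [CommRing R] [CommRing S] [Algebra R S]
    (φ : S →ₐ[R] S) {r : R} {x : S} (h : φ x = algebraMap R S r * x + 1) (k : ℕ) :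
    (φ ^ k) x = algebraMap R S (r ^ k) * x + algebraMap R S (∑ i ∈ Finset.range k, r ^ i) := by
  induction k with
  | zero => simp
  | succ k ih =>
    rw [pow_succ', AlgHom.mul_apply, ih, map_add, map_mul, AlgHom.commutes, AlgHom.commutes, h,
      Finset.sum_range_succ]
    simp only [map_add, map_mul, map_pow, pow_succ]
    ring

open Polynomial in
/-- If `f` is invariant under `X ↦ r X + 1`, where `r` has exponent `n` and the partial sums
`1 + r + ⋯ + r ^ (k - 1)` vanish for `k = n` and are units for `0 < k < n = deg f`, and
if `1 + (r - 1) X` is invertible modulo `f`, then `R[X]/(f)` is a cyclic Galois extension. -/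
theorem isGaloisExt_polyQuot {R : Type*} [CommRing R] {n : ℕ} [NeZero n] {f : R[X]}
    (hf : f.Monic) (hdeg : f.natDegree = n) {r : R} (hr : r ^ n = 1)
    (hsum : ∑ i ∈ Finset.range n, r ^ i = 0)
    (hunit : ∀ k, 0 < k → k < n → IsUnit (∑ i ∈ Finset.range k, r ^ i))
    (hinv : f.comp (C r * X + 1) = f)
    (hθ : IsUnit (Ideal.Quotient.mk (Ideal.span {f}) (1 + C (r - 1) * X))) :
    ∃ act : Multiplicative (ZMod n) →* (PolyQuot R f ≃ₐ[R] PolyQuot R f),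
      act (Multiplicative.ofAdd 1) (Ideal.Quotient.mk _ X) =
        Ideal.Quotient.mk _ (C r * X + 1) ∧
      IsGaloisExt R (PolyQuot R f) (Multiplicative (ZMod n)) act := by
  let pb : PowerBasis R (PolyQuot R f) := AdjoinRoot.powerBasis' hf
  have hdim : pb.dim = n := hdeg
  have hgen : pb.gen = Ideal.Quotient.mk (Ideal.span {f}) X := rfl
  have hC (x : R) : Ideal.Quotient.mk (Ideal.span {f}) (C x) =
    algebraMap R (PolyQuot R f) x := rfl
  let φ : PolyQuot R f →ₐ[R] PolyQuot R f :=
    Ideal.Quotient.liftₐ (Ideal.span {f})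
      ((Ideal.Quotient.mkₐ R (Ideal.span {f})).comp (aeval (C r * X + 1))) fun q hq => by
        obtain ⟨d, rfl⟩ := Ideal.mem_span_singleton.1 hq
        rw [map_mul, AlgHom.comp_apply, ← comp_eq_aeval, hinv, Ideal.Quotient.mkₐ_eq_mk,
          Ideal.Quotient.eq_zero_iff_mem.2 (Ideal.mem_span_singleton_self f), zero_mul]
  have hφ : φ pb.gen = algebraMap R (PolyQuot R f) r * pb.gen + 1 := by
    have : φ pb.gen = Ideal.Quotient.mk (Ideal.span {f}) (aeval (C r * X + 1) X) := rfl
    rw [this, aeval_X, map_add, map_mul, map_one, hC, hgen]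
  have hpow : φ ^ n = 1 := by
    refine pb.algHom_ext ?_
    rw [AlgHom.iterate_affine φ hφ, hr, hsum]
    simp
  let u : (PolyQuot R f →ₐ[R] PolyQuot R f)ˣ := Units.ofPowEqOne φ n hpow (NeZero.ne n)
  let σ : PolyQuot R f ≃ₐ[R] PolyQuot R f := AlgEquiv.algHomUnitsEquiv R (PolyQuot R f) u
  have hσ (k : ℕ) (x : PolyQuot R f) : (σ ^ k) x = (φ ^ k) x := by
    have : ((u ^ k : (PolyQuot R f →ₐ[R] PolyQuot R f)ˣ) : PolyQuot R f →ₐ[R] PolyQuot R f) =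
        φ ^ k := Units.val_pow_eq_pow_val u k
    rw [← this, ← map_pow]
    rfl
  have hσn : σ ^ n = 1 := by
    ext x
    rw [hσ, hpow]; rfl
  obtain ⟨act, hact⟩ := exists_zmod_hom n σ hσn
  have hactk (k : ℕ) : act (Multiplicative.ofAdd (k : ZMod n)) pb.gen =
      algebraMap R _ (r ^ k) * pb.gen +
        algebraMap R _ (∑ i ∈ Finset.range k, r ^ i) := by
    rw [← AlgHom.iterate_affine φ hφ, ← hσ, ← hact, ← map_pow, ← ofAdd_nsmul, nsmul_one]
  refine ⟨act, ?_, hf.finite_quotient, ?_, ?_⟩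
  · rw [← hgen, hact, ← pow_one σ, hσ, pow_one, hφ, hgen, map_add, map_mul, map_one, hC]
  · have := hf.free_quotient
    infer_instance
  · refine galMap_bijective_of_powerBasis act pb
      ((finCongr hdim).trans
        ((ZMod.finEquiv n).toEquiv.trans Multiplicative.ofAdd)) fun i j hij => ?_
    have he (i : Fin pb.dim) : ((finCongr hdim).trans
        ((ZMod.finEquiv n).toEquiv.trans Multiplicative.ofAdd)) i =
          Multiplicative.ofAdd ((i : ℕ) : ZMod n) :=
      congrArg Multiplicative.ofAdd (finEquiv_eq_natCast n (finCongr hdim i))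
    obtain ⟨d, hd⟩ := Nat.exists_eq_add_of_lt hij
    have hjn : (j : ℕ) < n := hdim ▸ j.2
    rw [he, he, hactk, hactk, show (j : ℕ) = i + (d + 1) by omega, Finset.sum_range_add]
    have key : algebraMap R (PolyQuot R f) (r ^ (i + (d + 1) : ℕ)) * pb.gen +
        algebraMap R _ (∑ x ∈ Finset.range i, r ^ x +
          ∑ x ∈ Finset.range (d + 1), r ^ ((i : ℕ) + x)) -
        (algebraMap R _ (r ^ (i : ℕ)) * pb.gen +
          algebraMap R _ (∑ x ∈ Finset.range i, r ^ x)) =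
        algebraMap R _ (r ^ (i : ℕ) * ∑ x ∈ Finset.range (d + 1), r ^ x) *
          Ideal.Quotient.mk (Ideal.span {f}) (1 + C (r - 1) * X) := by
      have hgs : r ^ (d + 1) = (∑ x ∈ Finset.range (d + 1), r ^ x) * (r - 1) + 1 := by
        rw [geom_sum_mul]; ring
      simp only [pow_add r (i : ℕ), ← Finset.mul_sum]
      rw [hgs, map_add (Ideal.Quotient.mk _), map_mul (Ideal.Quotient.mk _), map_one, hC, ← hgen]
      simp only [map_add, map_mul, map_one]
      ring
    rw [key]
    exact (((IsUnit.of_pow_eq_one hr (NeZero.ne n)).pow _).mul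
      (hunit _ (by omega) (by omega))).map _ |>.mul hθ

open Polynomial in
theorem monic_and_natDegree_eq_of_C_mul {R : Type*} [CommRing R] [IsDomain R] {n : ℕ}
    (hn : n ≠ 0) {f : R[X]} {c u : R} (hc : c ≠ 0)
    (hf : C (c ^ n) * f = (1 + C c * X) ^ n - C u) : f.Monic ∧ f.natDegree = n := by
  have hlin : (1 + C c * X : R[X]) = C c * X + C 1 := by rw [C_1, add_comm]
  have hdeg : ((1 + C c * X : R[X]) ^ n).natDegree = n := by
    rw [natDegree_pow, hlin, natDegree_linear hc, mul_one]
  have hcn : c ^ n ≠ 0 := pow_ne_zero n hc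
  have hfd : f.natDegree = n := by
    rw [← natDegree_C_mul (p := f) hcn, hf, natDegree_sub_C, hdeg]
  refine ⟨?_, hfd⟩
  have hcoeff := congrArg (fun q => coeff q n) hf
  have hlc : coeff ((1 + C c * X : R[X]) ^ n) n = c ^ n := by
    have h : leadingCoeff ((1 + C c * X : R[X]) ^ n) = c ^ n := by
      rw [leadingCoeff_pow, hlin, leadingCoeff_linear hc]
    rwa [leadingCoeff, hdeg] at h
  simp only [coeff_C_mul, coeff_sub, hlc, coeff_C, if_neg hn, sub_zero] at hcoeff
  rw [Monic, leadingCoeff, hfd]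
  exact mul_left_cancel₀ hcn (hcoeff.trans (mul_one _).symm)

open Polynomial in
theorem comp_affine_eq_of_C_mul {R : Type*} [CommRing R] [IsDomain R] {n : ℕ}
    {f : R[X]} {r u : R} (hc : r - 1 ≠ 0) (hr : r ^ n = 1)
    (hf : C ((r - 1) ^ n) * f = (1 + C (r - 1) * X) ^ n - C u) :
    f.comp (C r * X + 1) = f := by
  have hcn : C ((r - 1) ^ n) ≠ 0 := C_ne_zero.2 (pow_ne_zero n hc)
  refine mul_left_cancel₀ hcn ?_
  have h := congrArg (fun q => q.comp (C r * X + 1)) hf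
  simp only [mul_comp, C_comp, sub_comp, pow_comp, add_comp, one_comp, X_comp] at h
  have hlin : (1 + C (r - 1) * (C r * X + 1) : R[X]) = C r * (1 + C (r - 1) * X) := by
    simp only [C_sub, C_1]; ring
  rw [h, hf, hlin, mul_pow, ← C_pow, hr, C_1, one_mul]

open Polynomial in
theorem isUnit_mk_of_C_mul {R : Type*} [CommRing R] {n : ℕ} (hn : n ≠ 0)
    {f : R[X]} {c u : R} (hu : IsUnit u)
    (hf : C (c ^ n) * f = (1 + C c * X) ^ n - C u) :
    IsUnit (Ideal.Quotient.mk (Ideal.span {f}) (1 + C c * X)) := by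
  have h := congrArg (Ideal.Quotient.mk (Ideal.span {f})) hf
  rw [map_mul, Ideal.Quotient.eq_zero_iff_mem.2 (Ideal.mem_span_singleton_self f), mul_zero,
    map_sub, map_pow, eq_comm, sub_eq_zero] at h
  rw [← isUnit_pow_iff hn, h]
  exact (hu.map C).map _

theorem stmt10 (p : ℕ+) [Fact (p : ℕ).Prime]
    (ρ₀ : 𝓞 (CyclotomicField p ℚ)) (hρ₀ : IsPrimitiveRoot ρ₀ (p : ℕ))
    -- `g` is the polynomial with `(1 + Zη)^p = 1 + (g(Z) + Z^p)η^p`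
    (g : Polynomial (𝓞 (CyclotomicField p ℚ)))
    (hg : (1 + Polynomial.X * Polynomial.C (ρ₀ - 1)) ^ (p : ℕ) =
        1 + (g + Polynomial.X ^ (p : ℕ)) * Polynomial.C ((ρ₀ - 1) ^ (p : ℕ)))
    -- `R` a flat `ℤ[ρ]`-algebra which is an integrally closed domain
    (R : Type*) [CommRing R] [IsDomain R] [IsIntegrallyClosed R]
    [Algebra (𝓞 (CyclotomicField p ℚ)) R]
    [Module.Flat (𝓞 (CyclotomicField p ℚ)) R]
    (a : R) :
    -- if `1 + aη^p` is invertible, `T = R[Z]/(Z^p + g(Z) - a)` is cyclic Galois of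
    -- degree `p` over `R`, with Galois group generated by `σ : θ ↦ ρθ + 1`
    (IsUnit (1 + a * (algebraMap (𝓞 (CyclotomicField p ℚ)) R (ρ₀ - 1)) ^ (p : ℕ)) →
      ∃ act : Multiplicative (ZMod (p : ℕ)) →*
          ((PolyQuot R (Polynomial.X ^ (p : ℕ) +
              g.map (algebraMap (𝓞 (CyclotomicField p ℚ)) R) - Polynomial.C a)) ≃ₐ[R]
            (PolyQuot R (Polynomial.X ^ (p : ℕ) +
              g.map (algebraMap (𝓞 (CyclotomicField p ℚ)) R) - Polynomial.C a))),
        act (Multiplicative.ofAdd 1)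
            (Ideal.Quotient.mk _ Polynomial.X) =
          Ideal.Quotient.mk _
            (Polynomial.C (algebraMap (𝓞 (CyclotomicField p ℚ)) R ρ₀) * Polynomial.X + 1) ∧
        IsGaloisExt R
          (PolyQuot R (Polynomial.X ^ (p : ℕ) +
            g.map (algebraMap (𝓞 (CyclotomicField p ℚ)) R) - Polynomial.C a))
          (Multiplicative (ZMod (p : ℕ))) act) ∧
    -- conversely, if `1 + aη^p` is not invertible then `Z^p + g(Z) - a` is not separable
    (¬ IsUnit (1 + a * (algebraMap (𝓞 (CyclotomicField p ℚ)) R (ρ₀ - 1)) ^ (p : ℕ)) →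
      ¬ (Polynomial.X ^ (p : ℕ) +
          g.map (algebraMap (𝓞 (CyclotomicField p ℚ)) R) - Polynomial.C a).Separable) := by
  have hp : (p : ℕ).Prime := Fact.out
  have : NeZero (p : ℕ) := ⟨hp.ne_zero⟩
  have hinj : Function.Injective (algebraMap (𝓞 (CyclotomicField p ℚ)) R) :=
    FaithfulSMul.algebraMap_injective _ _
  set ι := algebraMap (𝓞 (CyclotomicField p ℚ)) R with hι
  have hρ : IsPrimitiveRoot (ι ρ₀) p := hρ₀.map_of_injective hinj
  have hη : ι ρ₀ - 1 ≠ 0 := sub_ne_zero.2 (hρ.ne_one hp.one_lt)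
  set f := Polynomial.X ^ (p : ℕ) + g.map ι - Polynomial.C a with hfdef
  have hf : Polynomial.C ((ι ρ₀ - 1) ^ (p : ℕ)) * f =
      (1 + Polynomial.C (ι ρ₀ - 1) * Polynomial.X) ^ (p : ℕ) -
        Polynomial.C (1 + a * (ι ρ₀ - 1) ^ (p : ℕ)) := by
    have h := congrArg (Polynomial.map ι) hg
    simp only [Polynomial.map_pow, Polynomial.map_add, Polynomial.map_mul, Polynomial.map_one,
      Polynomial.map_X, Polynomial.map_C, Polynomial.map_sub, map_sub, map_pow, map_one] at h
    simp only [hfdef, map_sub, map_pow, map_one, map_add, map_mul]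
    rw [mul_comm _ Polynomial.X, h]
    ring
  rw [map_sub, map_one]
  refine ⟨fun hu => ?_, fun hu hsep => hu (isUnit_of_separable hp.two_le hf hsep)⟩
  obtain ⟨hmonic, hdeg⟩ := monic_and_natDegree_eq_of_C_mul hp.ne_zero hη hf
  exact isGaloisExt_polyQuot hmonic hdeg hρ.pow_eq_one (hρ.geom_sum_eq_zero hp.one_lt)
    (fun k hk hkp => hρ.geom_sum_isUnit hp.two_le
      (Nat.coprime_of_lt_prime hk.ne' hkp hp).symm)
    (comp_affine_eq_of_C_mul hη hρ.pow_eq_one hf) (isUnit_mk_of_C_mul hp.ne_zero hu hf)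
end

section
/- Let p be an odd prime, μ, μ_m, η = μ - 1, η_m = μ_m - 1 as above. Then η_m^{p^m} = η·(1 + η^{p-2}·η_m·v) for some v ∈ ℤ[μ_m]. -/
/-- If `μ` is a primitive `p`-th root of unity, then `(μ - 1) ^ (p - 1)` divides `p`. -/
theorem sub_one_pow_dvd_of_isPrimitiveRoot {A : Type*} [CommRing A] [IsDomain A]
    {p : ℕ} (hp : 0 < p) {μ : A} (hμ : IsPrimitiveRoot μ p) :
    (μ - 1) ^ (p - 1) ∣ (p : A) := by
  obtain ⟨n, rfl⟩ : ∃ n, p = n + 1 := ⟨p - 1, by omega⟩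
  have h := hμ.prod_one_sub_pow_eq_order
  have hdvd : ∏ _k ∈ Finset.range n, (μ - 1) ∣ ∏ k ∈ Finset.range n, (1 - μ ^ (k + 1)) :=
    Finset.prod_dvd_prod_of_dvd _ _ fun k _ ↦
      (dvd_sub_comm).mp (by simpa using sub_dvd_pow_sub_pow μ 1 (k + 1))
  simpa [h] using hdvd

theorem stmt13 (p m : ℕ) (hp : p.Prime) (hodd : Odd p) (hm : 1 ≤ m)
    (L : Type*) [Field L] [CharZero L]
    (ζ : L) (hζ : IsPrimitiveRoot ζ (p ^ (m + 1))) :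
    ∃ v ∈ Algebra.adjoin ℤ ({ζ} : Set L),
      (ζ - 1) ^ (p ^ m) =
        (ζ ^ (p ^ m) - 1) * (1 + (ζ ^ (p ^ m) - 1) ^ (p - 2) * (ζ - 1) * v) := by
  let z : Algebra.adjoin ℤ ({ζ} : Set L) := ⟨ζ, Algebra.self_mem_adjoin_singleton ℤ ζ⟩
  have hz : IsPrimitiveRoot z (p ^ (m + 1)) :=
    IsPrimitiveRoot.coe_submonoidClass_iff.mp hζ
  have hμ : IsPrimitiveRoot (z ^ p ^ m) p :=
    hz.pow (pow_pos hp.pos _) (pow_succ p m)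
  obtain ⟨u, hu⟩ := sub_one_pow_dvd_of_isPrimitiveRoot hp.pos hμ
  obtain ⟨r, hr⟩ := exists_add_pow_prime_pow_eq hp (z - 1) 1 m
  have hpow : (z ^ p ^ m - 1) ^ (p - 1) = (z ^ p ^ m - 1) ^ (p - 2) * (z ^ p ^ m - 1) := by
    rw [← pow_succ]
    congr 1
    have := hp.two_le
    omega
  rw [sub_add_cancel, one_pow, mul_one, hu, hpow] at hr
  have key : (z - 1) ^ p ^ m =
      (z ^ p ^ m - 1) * (1 + (z ^ p ^ m - 1) ^ (p - 2) * (z - 1) * (-(u * r))) := by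
    linear_combination -hr
  exact ⟨_, (-(u * r)).2, congrArg Subtype.val key⟩
end
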